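/- arXiv:0904.0114 — 12 statements merged into one kernel-verified Lean document; each statement's English description precedes it below -/
import Mathlib

section
/- Let $n \ge 1$ be an integer, and let $\bar a_0 \le \bar a_1 \le \dots \le \bar a_n$ and $\bar d$ be positive real numbers such that $\bar d < \sum_{i=0}^{n}\bar a_i$ and $\bar d\big(\sum_{i=0}^{n}\bar a_i - \bar d\big)^{n} > n^{n}\prod_{i=0}^{n}\bar a_i$. Then $\sum_{i=0}^{n}\bar a_i - \bar d > n\,\bar a_0$. -/
/-- A homogeneous form of the Weierstrass product inequality `1 + ∑ xᵢ ≤ ∏ (1 + xᵢ)`. -/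
theorem sum_sub_mul_pow_le_prod {n : ℕ} (a : Fin (n + 1) → ℝ) {t : ℝ} (ht : 0 < t)
    (hta : ∀ i, t ≤ a i) : (∑ i, a i - n * t) * t ^ n ≤ ∏ i, a i := by
  induction n with
  | zero => simp
  | succ n ih =>
    have h := ih (fun i => a i.castSucc) (fun i => hta i.castSucc)
    have hlast := hta (Fin.last (n + 1))
    have hsum : (n + 1) * t ≤ ∑ i : Fin (n + 1), a i.castSucc := by
      simpa using Finset.card_nsmul_le_sum Finset.univ
        (fun i : Fin (n + 1) => a i.castSucc) t (fun i _ => hta i.castSucc)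
    rw [Fin.prod_univ_castSucc, Fin.sum_univ_castSucc]
    refine le_trans ?_ (mul_le_mul_of_nonneg_right h (ht.le.trans hlast))
    rw [pow_succ, mul_right_comm, mul_comm (t ^ n) t, ← mul_assoc]
    refine mul_le_mul_of_nonneg_right ?_ (pow_nonneg ht.le n)
    push_cast
    nlinarith [mul_nonneg (sub_nonneg.mpr hsum) (sub_nonneg.mpr hlast)]


/-- Bishop obstruction implies Lichnerowicz obstruction:
if `d (∑ aᵢ - d)^n > n^n ∏ aᵢ` with `0 < d < ∑ aᵢ` and
`a₀ ≤ a₁ ≤ … ≤ aₙ` positive reals, then `∑ aᵢ - d > n a₀`. -/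
theorem bishop_implies_lichnerowicz (n : ℕ) (hn : 1 ≤ n)
    (a : Fin (n + 1) → ℝ) (d : ℝ)
    (hmono : Monotone a) (hpos : ∀ i, 0 < a i) (hd : 0 < d)
    (hdlt : d < ∑ i, a i)
    (hbishop : d * (∑ i, a i - d) ^ n > (n : ℝ) ^ n * ∏ i, a i) :
    ∑ i, a i - d > (n : ℝ) * a 0 := by
  by_contra! hle
  have hn0 : (0 : ℝ) < n := by exact_mod_cast hn
  obtain ⟨t, ht⟩ : ∃ t : ℝ, ∑ i, a i - d = n * t :=
    ⟨(∑ i, a i - d) / n, by field_simp⟩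
  have ht0 : 0 < t := pos_of_mul_pos_right (ht ▸ sub_pos.mpr hdlt) hn0.le
  have hta : ∀ i, t ≤ a i := fun i =>
    (le_of_mul_le_mul_left (ht ▸ hle) hn0).trans (hmono (Fin.zero_le i))
  have hprod := sum_sub_mul_pow_le_prod a ht0 hta
  rw [show ∑ i, a i - n * t = d by linarith] at hprod
  rw [ht, mul_pow] at hbishop
  have := mul_le_mul_of_nonneg_left hprod (pow_nonneg hn0.le n)
  linarith
end

section
/- Let $n \ge 1$ be an integer, let $a_1,\dots,a_n$ be real numbers with $a_i \ge 1$ for every $i$, and let $\alpha$ be a real number with $0 < \alpha \le 1$. Then $\big(\sum_{i=1}^{n} a_i + 1 - \alpha n\big)\alpha^{n} \le \prod_{i=1}^{n} a_i$. -/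
theorem Finset.sum_sub_add_one_mul_pow_card_le_prod {ι : Type*} (s : Finset ι) (a : ι → ℝ) {α : ℝ}
    (hα₀ : 0 ≤ α) (hα₁ : α ≤ 1) (ha : ∀ i ∈ s, α ≤ a i) :
    (∑ i ∈ s, (a i - α) + 1) * α ^ s.card ≤ ∏ i ∈ s, a i := by
  classical
  induction s using Finset.induction_on with
  | empty => simp
  | insert j s hj ih =>
    have ha' : ∀ i ∈ s, α ≤ a i := fun i hi => ha i (Finset.mem_insert_of_mem hi)
    have hd : 0 ≤ a j - α := sub_nonneg.2 (ha j (Finset.mem_insert_self j s))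
    have hS : 0 ≤ ∑ i ∈ s, (a i - α) :=
      Finset.sum_nonneg fun i hi => sub_nonneg.2 (ha' i hi)
    rw [Finset.sum_insert hj, Finset.prod_insert hj, Finset.card_insert_of_notMem hj, pow_succ]
    have h₁ := mul_le_mul_of_nonneg_left (ih ha') (by linarith : 0 ≤ a j)
    have h₂ : 0 ≤ (a j - α) * α ^ s.card * (∑ i ∈ s, (a i - α) + 1 - α) :=
      mul_nonneg (mul_nonneg hd (pow_nonneg hα₀ _)) (by linarith)
    linarith

/-- If `a₁, …, aₙ ≥ 1` are real numbers and `0 < α ≤ 1`, then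
`(∑ aᵢ + 1 - α n) αⁿ ≤ ∏ aᵢ`. -/
theorem normalized_bishop_inequality (n : ℕ) (hn : 1 ≤ n)
    (a : Fin n → ℝ) (ha : ∀ i, 1 ≤ a i)
    (α : ℝ) (hα₀ : 0 < α) (hα₁ : α ≤ 1) :
    (∑ i, a i + 1 - α * n) * α ^ n ≤ ∏ i, a i := by
  have h := Finset.univ.sum_sub_add_one_mul_pow_card_le_prod a hα₀.le hα₁
    fun i _ => hα₁.trans (ha i)
  simp only [Finset.sum_sub_distrib, Finset.sum_const, Finset.card_univ, Fintype.card_fin,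
    nsmul_eq_mul] at h
  linarith
end

section
/- Let $a_0 \le a_1 \le a_2 \le a_3$ be positive integers and put $d = a_0 + a_1 + a_2 + a_3 - 2$ (so the index is $I = 2$). Assume: (a) there exist indices $i, j \in \{0,1,2,3\}$ with $i \ne j$ and $2a_i + a_j = 4$; (b) $\gcd(a_i,a_j,a_k)=1$ for all pairwise distinct indices $i,j,k$ and $\gcd(a_i,a_j)$ divides $d$ for all distinct indices $i,j$; (c) there exists a positive integer $n$ with $d - n a_3 \in \{0, a_0, a_1, a_2\}$. Then either $(a_0,a_1,a_2,a_3,d) = (1,1,1,2,3)$, or $(a_0,a_1,a_2,a_3,d) = (1,1,2,a_3,a_3+2)$ with $a_3 \ge 2$, or $(a_0,a_1,a_2,a_3,d) = (1,2,a_2,a_2+1,2a_2+2)$ with $a_2 \ge 2$. -/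
/-- Classification of well-formed quasismooth Yu-type surfaces of index `I = 2`. -/
theorem yu_type_index_two (a : Fin 4 → ℕ) (d : ℕ)
    (hpos : ∀ i, 0 < a i)
    (h01 : a 0 ≤ a 1) (h12 : a 1 ≤ a 2) (h23 : a 2 ≤ a 3)
    (hd : d + 2 = a 0 + a 1 + a 2 + a 3)
    -- (a): Yu-type of index 2, i.e. `2 = aᵢ + aⱼ/2` for some `i ≠ j`
    (hyu : ∃ i j : Fin 4, i ≠ j ∧ 2 * a i + a j = 4)
    -- (b): well-formedness
    (hwf3 : ∀ i j k : Fin 4, i ≠ j → i ≠ k → j ≠ k →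
      Nat.gcd (Nat.gcd (a i) (a j)) (a k) = 1)
    (hwf2 : ∀ i j : Fin 4, i ≠ j → Nat.gcd (a i) (a j) ∣ d)
    -- (c): arithmetic consequence of quasismoothness for the last variable
    (hqs : ∃ n : ℕ, 0 < n ∧
      (d = n * a 3 ∨ d = n * a 3 + a 0 ∨ d = n * a 3 + a 1 ∨ d = n * a 3 + a 2)) :
    (a 0 = 1 ∧ a 1 = 1 ∧ a 2 = 1 ∧ a 3 = 2 ∧ d = 3) ∨
    (a 0 = 1 ∧ a 1 = 1 ∧ a 2 = 2 ∧ 2 ≤ a 3 ∧ d = a 3 + 2) ∨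
    (a 0 = 1 ∧ a 1 = 2 ∧ 2 ≤ a 2 ∧ a 3 = a 2 + 1 ∧ d = 2 * a 2 + 2) := by
  have hp : 0 < a 0 := hpos 0
  have h_one_two : a 0 = 1 ∧ (a 1 = 2 ∨ a 2 = 2 ∨ a 3 = 2) := by
    obtain ⟨i, j, -, h⟩ := hyu
    have hi := hpos i
    have hj := hpos j
    have hai : a i = 1 := by omega
    have haj : a j = 2 := by omega
    clear hi hj h
    fin_cases i <;> fin_cases j <;> simp at hai haj <;> omega
  obtain ⟨h0, h2⟩ := h_one_two
  by_cases h1 : a 1 = 1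
  · omega
  have h1 : a 1 = 2 := by omega
  have hne : a 2 ≠ a 3 := by
    intro heq
    have hdvd : a 2 ∣ d := by simpa [← heq] using hwf2 2 3 (by decide)
    have hsum : d = 2 * a 2 + 1 := by omega
    rw [hsum, Nat.dvd_add_right (Dvd.intro_left 2 rfl), Nat.dvd_one] at hdvd
    omega
  obtain ⟨n, hn, h⟩ := hqs
  obtain rfl | rfl | hn3 : n = 1 ∨ n = 2 ∨ 3 ≤ n := by omega
  · omega
  · omega
  · have := Nat.mul_le_mul_right (a 3) hn3
    omega
end

section
/- Let $k \in \{0,1\}$ and let $a$ be an integer with $a \ge 2 + k$. Put $(a_0,a_1,a_2,a_3) = (2-k, 2+k, a, a+k)$ and $d = 2a + k + 2$ (so the index is $I = 2$). Assume: (a) $\gcd(a_i,a_j,a_k)=1$ for all pairwise distinct indices and $\gcd(a_i,a_j)$ divides $d$ for all distinct indices; (b) there exists a positive integer $m$ with $d - m(2+k) \in \{0, 2-k, a, a+k\}$. Then $k = 1$ and there exists a positive integer $n$ such that either $(a_0,a_1,a_2,a_3,d) = (1,3,3n,3n+1,6n+3)$ or $(a_0,a_1,a_2,a_3,d) = (1,3,3n+1,3n+2,6n+5)$.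 -/
/-- Classification of well-formed quasismooth Boyer-type surfaces of index `I = 2`. -/
theorem boyer_type_index_two (k a d : ℕ) (hk : k ≤ 1) (ha : 2 + k ≤ a)
    (w : Fin 4 → ℕ) (hw : w = ![2 - k, 2 + k, a, a + k])
    (hd : d = 2 * a + k + 2)
    -- (a): well-formedness
    (hwf3 : ∀ i j l : Fin 4, i ≠ j → i ≠ l → j ≠ l →
      Nat.gcd (Nat.gcd (w i) (w j)) (w l) = 1)
    (hwf2 : ∀ i j : Fin 4, i ≠ j → Nat.gcd (w i) (w j) ∣ d)
    -- (b): arithmetic consequence of quasismoothness for the variable of weight `2 + k`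
    (hqs : ∃ m : ℕ, 0 < m ∧
      (d = m * (2 + k) ∨ d = m * (2 + k) + (2 - k) ∨
        d = m * (2 + k) + a ∨ d = m * (2 + k) + (a + k))) :
    k = 1 ∧ ∃ n : ℕ, 0 < n ∧
      ((a = 3 * n ∧ w = ![1, 3, 3 * n, 3 * n + 1] ∧ d = 6 * n + 3) ∨
        (a = 3 * n + 1 ∧ w = ![1, 3, 3 * n + 1, 3 * n + 2] ∧ d = 6 * n + 5)) := by
  subst hw hd
  obtain rfl | rfl : k = 0 ∨ k = 1 := by omega
  · exfalso
    have h3 : Nat.gcd (Nat.gcd 2 2) a = 1 := by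
      simpa using hwf3 0 1 2 (by decide) (by decide) (by decide)
    have h2 : a ∣ 2 * a + 2 := by simpa using hwf2 2 3 (by decide)
    have h2' : a ∣ 2 := (Nat.dvd_add_right (Dvd.intro_left 2 rfl)).mp h2
    obtain rfl : a = 2 := le_antisymm (Nat.le_of_dvd two_pos h2') ha
    norm_num at h3
  · have h3 : Nat.gcd 3 (a + 1) ∣ 2 * a + 1 + 2 := by
      simpa using hwf2 1 3 (by decide)
    have hmod : a % 3 ≠ 2 := by
      intro h
      rw [Nat.gcd_eq_left (by omega)] at h3
      omega
    refine ⟨rfl, a / 3, by omega, ?_⟩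
    obtain h | h : a = 3 * (a / 3) ∨ a = 3 * (a / 3) + 1 := by omega
    · refine Or.inl ⟨h, ?_, by omega⟩
      rw [← h]
    · refine Or.inr ⟨h, ?_, by omega⟩
      rw [show 3 * (a / 3) + 2 = a + 1 by omega, ← h]
end

section
/- Let $I, k, a$ be integers with $0 \le k < I$ and $a \ge 1$, and put $(a_0,a_1,a_2,a_3,d) = (I-k, I+k, a, a+k, 2a+k+I)$. Assume: (a) $\gcd(a_i,a_j,a_k)=1$ for all pairwise distinct indices and $\gcd(a_i,a_j)$ divides $d$ for all distinct indices; (b) there exists a positive integer $p$ with $d - p\,a_1 \in \{0, a_0, a_2, a_3\}$; (c) there exists a positive integer $q$ with $d - q\,a_0 \in \{0, a_1, a_2, a_3\}$. Then one of the following holds: (1) $a \ge I + k$; (2) there exists a positive integer $m$ with $(a_0,a_1,a_2,a_3,d) = (2, 4m-2, 2m-1, 4m-3, 8m-4)$ (in which case $I = a_0/2 + a_2$); (3) $(a_0,a_1,a_2,a_3,d) = (1,3,1,2,5)$ with $I = 2$; (4) $(a_0,a_1,a_2,a_3,d) = (3,5,1,2,7)$ with $I = 4$. -/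
/-- The quasismoothness condition at the weight `I + k` forces a linear relation
as soon as `a < I + k`. -/
theorem weight_relation_of_lt {I k a : ℕ} (hk : k < I) (ha : 1 ≤ a) (hab : a < I + k)
    (hqs : ∃ p : ℕ, 0 < p ∧
      (2 * a + k + I = p * (I + k) ∨ 2 * a + k + I = p * (I + k) + (I - k) ∨
        2 * a + k + I = p * (I + k) + a ∨ 2 * a + k + I = p * (I + k) + (a + k))) :
    I = k + 2 * a ∨ a = k ∨ 2 * a = I + k ∨ a = I := by
  obtain ⟨p, hp, h⟩ := hqs
  have hp3 : p < 3 := by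
    by_contra hc
    have : 3 * (I + k) ≤ p * (I + k) := Nat.mul_le_mul_right _ (by omega)
    omega
  interval_cases p <;> omega

theorem eq_one_and_eq_zero_of_eq_add_two_mul {I k a : ℕ} (h : I = k + 2 * a)
    (hdvd : Nat.gcd (I + k) (a + k) ∣ 2 * a + k + I)
    (hcop : ∀ x, x ∣ I - k → x ∣ I + k → x ∣ a + k → x = 1) (ha : 1 ≤ a) :
    a = 1 ∧ k = 0 := by
  have hI : I + k = 2 * (a + k) := by omega
  rw [Nat.gcd_eq_right (Dvd.intro_left 2 hI.symm)] at hdvd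
  have h2 : a + k ∣ 2 * a := by
    have : 2 * a + k + I = 2 * a + 2 * (a + k) := by omega
    rwa [this, Nat.dvd_add_left (Dvd.intro_left 2 rfl)] at hdvd
  have := hcop (a + k) (by rwa [show I - k = 2 * a by omega])
    (Dvd.intro_left 2 hI.symm) dvd_rfl
  omega

/-- The weights `(I - 1, I + 1, 1, 2)` in degree `I + 3` are only possible for `I = 2, 4`. -/
theorem eq_two_or_four_of_weights {I : ℕ} (hI : 1 < I)
    (hcop : ∀ x, x ∣ I - 1 → x ∣ I + 1 → x ∣ 1 + 1 → x = 1)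
    (hqs : ∃ q : ℕ, 0 < q ∧
      (2 * 1 + 1 + I = q * (I - 1) ∨ 2 * 1 + 1 + I = q * (I - 1) + (I + 1) ∨
        2 * 1 + 1 + I = q * (I - 1) + 1 ∨ 2 * 1 + 1 + I = q * (I - 1) + (1 + 1))) :
    I = 2 ∨ I = 4 := by
  have heven : I % 2 = 0 := by
    by_contra hne
    have := hcop 2 (by omega) (by omega) (by omega)
    omega
  obtain ⟨q, hq, h⟩ := hqs
  have hI5 : I ≤ 5 := by
    by_contra hc
    rcases Nat.lt_or_ge q 2 with hq2 | hq2
    · interval_cases q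
      omega
    · have : 2 * (I - 1) ≤ q * (I - 1) := Nat.mul_le_mul_right _ hq2
      omega
  omega

/-- For `2a = I + k` with `a` odd, the condition at the weight `I - k` forces `a = k + 1`. -/
theorem eq_succ_of_two_mul_eq {I k a : ℕ} (hk : k < I) (h : 2 * a = I + k)
    (h012 : ∀ x, x ∣ I - k → x ∣ I + k → x ∣ a → x = 1)
    (h013 : ∀ x, x ∣ I - k → x ∣ I + k → x ∣ a + k → x = 1)
    (hqs : ∃ q : ℕ, 0 < q ∧
      (2 * a + k + I = q * (I - k) ∨ 2 * a + k + I = q * (I - k) + (I + k) ∨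
        2 * a + k + I = q * (I - k) + a ∨ 2 * a + k + I = q * (I - k) + (a + k)))
    (hodd : a % 2 = 1) : a = k + 1 := by
  obtain ⟨c, rfl⟩ : ∃ c, a = k + c := ⟨a - k, by omega⟩
  have hI : I = k + 2 * c := by omega
  subst hI
  rw [show k + 2 * c - k = c * 2 by omega] at *
  have hcop : Nat.Coprime c (k + c) := by
    refine h012 _ ((Nat.gcd_dvd_left _ _).mul_right 2) ?_ (Nat.gcd_dvd_right _ _)
    rw [← h]
    exact (Nat.gcd_dvd_right _ _).mul_left 2
  have hc2 : c ≠ 2 := by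
    rintro rfl
    have := h013 2 (by omega) (by omega) (by omega)
    omega
  have hdvd : c ∣ 2 := by
    obtain ⟨q, -, hq | hq | hq | hq⟩ := hqs
    · refine hcop.dvd_of_dvd_mul_right (n := k + c) ⟨q, ?_⟩
      linarith
    · refine hcop.dvd_of_dvd_mul_right (n := k + c) ⟨q * 2, ?_⟩
      linarith
    · have : 3 * (k + c) = 2 * (q * c) := by linarith
      omega
    · refine hcop.dvd_of_dvd_mul_right (n := k + c) ⟨q * 2 - 1, ?_⟩
      have hq1 : 1 ≤ q * 2 := by
        by_contra hc
        obtain rfl : q = 0 := by omega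
        omega
      zify [hq1] at hq ⊢
      linarith
  have := Nat.le_of_dvd two_pos hdvd
  interval_cases c <;> omega


/-- For a well-formed quasismooth surface with weights
`(I - k, I + k, a, a + k)` and degree `2a + k + I` (`0 ≤ k < I`, `a ≥ 1`),
either `a ≥ I + k`, or the surface belongs to the series
`(2, 4m - 2, 2m - 1, 4m - 3, 8m - 4)`, or it is one of the two sporadic
cases `(1, 3, 1, 2, 5)` (with `I = 2`) and `(3, 5, 1, 2, 7)` (with `I = 4`). -/
theorem boyer_type_ordered (I k a d : ℕ) (hk : k < I) (ha : 1 ≤ a)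
    (w : Fin 4 → ℕ) (hw : w = ![I - k, I + k, a, a + k])
    (hd : d = 2 * a + k + I)
    -- (a): well-formedness
    (hwf3 : ∀ i j l : Fin 4, i ≠ j → i ≠ l → j ≠ l →
      Nat.gcd (Nat.gcd (w i) (w j)) (w l) = 1)
    (hwf2 : ∀ i j : Fin 4, i ≠ j → Nat.gcd (w i) (w j) ∣ d)
    -- (b): quasismoothness condition for the variable of weight `I + k`
    (hqs1 : ∃ p : ℕ, 0 < p ∧
      (d = p * (I + k) ∨ d = p * (I + k) + (I - k) ∨
        d = p * (I + k) + a ∨ d = p * (I + k) + (a + k)))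
    -- (c): quasismoothness condition for the variable of weight `I - k`
    (hqs0 : ∃ q : ℕ, 0 < q ∧
      (d = q * (I - k) ∨ d = q * (I - k) + (I + k) ∨
        d = q * (I - k) + a ∨ d = q * (I - k) + (a + k))) :
    I + k ≤ a ∨
    (∃ m : ℕ, 0 < m ∧
      w = ![2, 4 * m - 2, 2 * m - 1, 4 * m - 3] ∧ d = 8 * m - 4) ∨
    (w = ![1, 3, 1, 2] ∧ d = 5 ∧ I = 2) ∨
    (w = ![3, 5, 1, 2] ∧ d = 7 ∧ I = 4) := by
  have coprime3 : ∀ {i j l : Fin 4}, i ≠ j → i ≠ l → j ≠ l →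
      ∀ x, x ∣ w i → x ∣ w j → x ∣ w l → x = 1 := fun {i j l} hij hil hjl x hi hj hl =>
    Nat.dvd_one.mp (hwf3 i j l hij hil hjl ▸ Nat.dvd_gcd (Nat.dvd_gcd hi hj) hl)
  have h012 := coprime3 (i := 0) (j := 1) (l := 2) (by decide) (by decide) (by decide)
  have h013 := coprime3 (i := 0) (j := 1) (l := 3) (by decide) (by decide) (by decide)
  have h023 := coprime3 (i := 0) (j := 2) (l := 3) (by decide) (by decide) (by decide)
  have g13 := hwf2 1 3 (by decide)
  have g23 := hwf2 2 3 (by decide)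
  have w0 : w 0 = I - k := by simp [hw]
  have w1 : w 1 = I + k := by simp [hw]
  have w2 : w 2 = a := by simp [hw]
  have w3 : w 3 = a + k := by simp [hw]
  rw [w0, w1, w2] at h012
  rw [w0, w1, w3] at h013
  rw [w0, w2, w3] at h023
  rw [w1, w3] at g13
  rw [w2, w3] at g23
  clear coprime3 hwf3 hwf2 w0 w1 w2 w3
  rcases Nat.lt_or_ge a (I + k) with hab | hab
  swap
  · exact Or.inl hab
  right
  subst hd
  have key : I = k + 2 * a ∨ a = k ∨ 2 * a = I + k ∨ a = I :=
    weight_relation_of_lt hk ha hab hqs1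
  rcases key with h | h | h | h
  · left
    obtain ⟨rfl, rfl⟩ := eq_one_and_eq_zero_of_eq_add_two_mul h g13 h013 ha
    exact ⟨1, one_pos, by simp [hw, h], by omega⟩
  · subst h
    right
    have ha1 : a = 1 := by
      have hg : a ∣ I := by
        rw [Nat.gcd_eq_left (Dvd.intro_left 2 (by ring))] at g23
        rwa [Nat.dvd_add_right (Dvd.intro_left 3 (by ring))] at g23
      exact h023 a (Nat.dvd_sub hg dvd_rfl) dvd_rfl (Dvd.intro_left 2 (by ring))
    subst ha1
    rcases eq_two_or_four_of_weights hk h013 hqs0 with rfl | rfl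
    · left; simp [hw]
    · right; simp [hw]
  · left
    have hodd : a % 2 = 1 := by
      by_contra hne
      have := h012 2 (by omega) (by omega) (by omega)
      omega
    have hIk : a = k + 1 := eq_succ_of_two_mul_eq hk h h012 h013 hqs0 hodd
    refine ⟨(a + 1) / 2, by omega, ?_, by omega⟩
    rw [hw]
    congr! 1
    · omega
    congr! 1
    · omega
    congr! 1
    · omega
    congr! 1
    omega
  · subst h
    exfalso
    rw [Nat.gcd_self] at g13
    have h2 : a + k ∣ 2 * a := by
      have : 2 * a + k + a = 2 * a + (a + k) := by ring
      rwa [this, Nat.dvd_add_left dvd_rfl] at g13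
    obtain ⟨t, ht⟩ := h2
    have : t < 2 := by
      by_contra hc
      nlinarith
    interval_cases t <;> omega
end

section
/- Let $I, k, a$ be integers with $0 \le k < I$ and $a \ge 1$, put $(a_0,a_1,a_2,a_3,d) = (I-k, I+k, a, a+k, 2a+k+I)$, and assume additionally that $2I \le 3\min(a_0,a_1,a_2,a_3)$. Assume: (a) $\gcd(a_i,a_j,a_k)=1$ for all pairwise distinct indices and $\gcd(a_i,a_j)$ divides $d$ for all distinct indices; (b) there exists a positive integer $p$ with $d - p\,a_1 \in \{0, a_0, a_2, a_3\}$; (c) there exists a positive integer $q$ with $d - q\,a_0 \in \{0, a_1, a_2, a_3\}$. Then $a \ge I + k$. -/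
/-- For a well-formed quasismooth surface with weights
`(I - k, I + k, a, a + k)` and degree `2a + k + I` (`0 ≤ k < I`, `a ≥ 1`),
if moreover `2I ≤ 3 min(a₀, a₁, a₂, a₃)`, then `a ≥ I + k`. -/
theorem boyer_type_ordered_of_small_index (I k a d : ℕ) (hk : k < I) (ha : 1 ≤ a)
    (w : Fin 4 → ℕ) (hw : w = ![I - k, I + k, a, a + k])
    (hd : d = 2 * a + k + I)
    (hmin : 2 * I ≤ 3 * min (min (w 0) (w 1)) (min (w 2) (w 3)))
    -- (a): well-formedness
    (hwf3 : ∀ i j l : Fin 4, i ≠ j → i ≠ l → j ≠ l →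
      Nat.gcd (Nat.gcd (w i) (w j)) (w l) = 1)
    (hwf2 : ∀ i j : Fin 4, i ≠ j → Nat.gcd (w i) (w j) ∣ d)
    -- (b): quasismoothness condition for the variable of weight `I + k`
    (hqs1 : ∃ p : ℕ, 0 < p ∧
      (d = p * (I + k) ∨ d = p * (I + k) + (I - k) ∨
        d = p * (I + k) + a ∨ d = p * (I + k) + (a + k)))
    -- (c): quasismoothness condition for the variable of weight `I - k`
    (hqs0 : ∃ q : ℕ, 0 < q ∧
      (d = q * (I - k) ∨ d = q * (I - k) + (I + k) ∨
        d = q * (I - k) + a ∨ d = q * (I - k) + (a + k))) :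
    I + k ≤ a := by
  subst hw
  have hgcd3 : Nat.gcd (Nat.gcd (I - k) (I + k)) a = 1 :=
    hwf3 0 1 2 (by decide) (by decide) (by decide)
  have hgcd2 : Nat.gcd (I + k) (a + k) ∣ d := hwf2 1 3 (by decide)
  have hmin' : 2 * I ≤ 3 * min (min (I - k) (I + k)) (min a (a + k)) := hmin
  have hkI : 3 * k ≤ I := by omega
  have haI : 2 * I ≤ 3 * a := by omega
  clear hmin hmin' hwf3 hwf2 hqs0
  by_contra! hlt
  obtain ⟨p, hp, h | h | h | h⟩ := hqs1
  · -- Only `p = 2` survives, which forces the weights `(2k, 4k, 2k, 3k)`.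
    have hp2 : p = 2 := by
      have h1 : p < 3 := by by_contra! h3; nlinarith
      have h2 : p ≠ 1 := by rintro rfl; omega
      omega
    subst hp2
    have h0 : I - k = 2 * k := by omega
    have h1 : I + k = 2 * (2 * k) := by omega
    have h2 : a = 2 * k := by omega
    rw [h0, h1, h2, Nat.gcd_mul_left_right, Nat.gcd_self] at hgcd3
    omega
  · -- Only `p = 2` survives, which forces `a = I`, so that `I + k` divides `d = 3I + k`.
    have hp2 : p = 2 := by
      have h1 : p < 3 := by
        by_contra! h3
        have := Nat.mul_le_mul_right (I + k) h3
        omega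
      have h2 : p ≠ 1 := by rintro rfl; omega
      omega
    subst hp2
    have haI' : a = I := by omega
    subst haI'
    rw [Nat.gcd_self] at hgcd2
    obtain ⟨c, hc⟩ := hgcd2
    have hc3 : c < 3 := by by_contra! h3; nlinarith
    interval_cases c <;> omega
  · have hp1 : p < 2 := by by_contra! h2; nlinarith
    interval_cases p
    omega
  · have hp1 : p < 2 := by
      by_contra! h2
      have := Nat.mul_le_mul_right (I + k) h2
      omega
    interval_cases p
    omega
end

section
/- Let $a_0, a_1, a_2, a_3$ be positive integers and let $u$ be an integer with $5 \le u \le 18$ such that $2a_0 = 3a_1 + a_2 = 5a_2 + a_3 = a_1 + u\,a_3$, and put $d = 2a_0$. Suppose that $\gcd(a_i,a_j,a_k)=1$ for all pairwise distinct indices $i,j,k$ and $\gcd(a_i,a_j)$ divides $d$ for all distinct indices $i,j$. Then $(a_0,a_1,a_2,a_3,d)$ is one of: $(38,21,13,11,76)$, $(53,29,19,11,106)$, $(68,37,25,11,136)$, $(83,45,31,11,166)$, $(98,53,37,11,196)$, $(113,61,43,11,226)$, $(128,69,49,11,256)$ (corresponding to $u = 5, 7, 9, 11, 13, 15, 17$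 respectively). -/
/-- Case X.3(1) of the Yau–Yu classification: the defining polynomial
`x² + y³z + z⁵w + ywᵘ` with `5 ≤ u ≤ 18` and a well-formed weight system
yields exactly seven quintuples `(a₀, a₁, a₂, a₃, d)`. -/
theorem case_X_3_1 (a : Fin 4 → ℕ) (d u : ℕ) (hpos : ∀ i, 0 < a i)
    (hu₁ : 5 ≤ u) (hu₂ : u ≤ 18)
    (h1 : 2 * a 0 = 3 * a 1 + a 2)
    (h2 : 2 * a 0 = 5 * a 2 + a 3)
    (h3 : 2 * a 0 = a 1 + u * a 3)
    (hd : d = 2 * a 0)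
    (hwf3 : ∀ i j k : Fin 4, i ≠ j → i ≠ k → j ≠ k →
      Nat.gcd (Nat.gcd (a i) (a j)) (a k) = 1)
    (hwf2 : ∀ i j : Fin 4, i ≠ j → Nat.gcd (a i) (a j) ∣ d) :
    (a 0, a 1, a 2, a 3, d) = (38, 21, 13, 11, 76) ∨
    (a 0, a 1, a 2, a 3, d) = (53, 29, 19, 11, 106) ∨
    (a 0, a 1, a 2, a 3, d) = (68, 37, 25, 11, 136) ∨
    (a 0, a 1, a 2, a 3, d) = (83, 45, 31, 11, 166) ∨
    (a 0, a 1, a 2, a 3, d) = (98, 53, 37, 11, 196) ∨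
    (a 0, a 1, a 2, a 3, d) = (113, 61, 43, 11, 226) ∨
    (a 0, a 1, a 2, a 3, d) = (128, 69, 49, 11, 256) := by
  have common {k : ℕ} (hy : k ∣ a 1) (hz : k ∣ a 2) (hw : k ∣ a 3) : k = 1 := by
    have h := Nat.dvd_gcd (Nat.dvd_gcd hy hz) hw
    rwa [hwf3 1 2 3 (by decide) (by decide) (by decide), Nat.dvd_one] at h
  -- The equalities force `(a 1, a 2, a 3, d)` to be proportional to
  -- `(4 * u + 1, 3 * u - 2, 11, 15 * u + 1)`.
  obtain ⟨v, rfl | rfl⟩ := Nat.even_or_odd' u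
  · have hv : v ≤ 9 := by omega
    have hv' : 3 ≤ v := by omega
    have h_two : 2 ∣ a 1 ∧ 2 ∣ a 2 ∧ 2 ∣ a 3 := by
      interval_cases v <;> omega
    have := common h_two.1 h_two.2.1 h_two.2.2
    omega
  · have hv : v ≤ 8 := by omega
    have hv' : 2 ≤ v := by omega
    obtain ⟨k, hk⟩ : 11 ∣ a 3 := by interval_cases v <;> omega
    have hy : a 1 = k * (8 * v + 5) := by interval_cases v <;> omega
    have hz : a 2 = k * (6 * v + 1) := by interval_cases v <;> omega
    obtain rfl : k = 1 := common ⟨_, hy⟩ ⟨_, hz⟩ ⟨11, by rw [hk, mul_comm]⟩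
    have h0 : a 0 = 15 * v + 8 := by omega
    simp only [Prod.mk.injEq, hd, h0, hy, hz, hk]
    interval_cases v <;> simp
end

section
/- Let $a_0, a_1, a_2, a_3$ be positive integers and let $s$ be an integer with $s \ge 4$ such that $2a_0 + a_2 = a_0 + 2a_1 = a_1 + s\,a_2 = a_1 + 3a_3$, and put $d = 2a_0 + a_2$. Suppose that $\gcd(a_i,a_j,a_k)=1$ for all pairwise distinct indices $i,j,k$ and $\gcd(a_i,a_j)$ divides $d$ for all distinct indices $i,j$. Then there exists a positive integer $n$ such that $(a_0, a_1, a_2, a_3, d) = (6n+1, 3n+2, 3, 3n+1, 12n+5)$. -/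
/-- Case XVIII.2(2) of the Yau–Yu classification: the defining polynomial
`x²z + xy² + yzˢ + yw³ + ⋯` with `s ≥ 4` and a well-formed weight system
yields the infinite series `(6n+1, 3n+2, 3, 3n+1, 12n+5)` of index 2. -/
theorem case_XVIII_2_2 (a : Fin 4 → ℕ) (d s : ℕ) (hpos : ∀ i, 0 < a i)
    (hs : 4 ≤ s)
    (e1 : 2 * a 0 + a 2 = a 0 + 2 * a 1)
    (e2 : 2 * a 0 + a 2 = a 1 + s * a 2)
    (e3 : 2 * a 0 + a 2 = a 1 + 3 * a 3)
    (hd : d = 2 * a 0 + a 2)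
    (hwf3 : ∀ i j k : Fin 4, i ≠ j → i ≠ k → j ≠ k →
      Nat.gcd (Nat.gcd (a i) (a j)) (a k) = 1)
    (hwf2 : ∀ i j : Fin 4, i ≠ j → Nat.gcd (a i) (a j) ∣ d) :
    ∃ n : ℕ, 0 < n ∧
      (a 0, a 1, a 2, a 3, d) = (6 * n + 1, 3 * n + 2, 3, 3 * n + 1, 12 * n + 5) := by
  obtain ⟨k, hk⟩ : ∃ k, a 1 = a 3 + k := Nat.exists_eq_add_of_le (by lia)
  have h2 : a 2 = 3 * k := by lia
  have h3 : a 3 = s * k := by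
    rw [h2] at e1 e2 e3
    have : s * (3 * k) = 3 * (s * k) := by ring
    lia
  have h012 : Nat.gcd (Nat.gcd (a 0) (a 1)) (a 2) = 1 :=
    hwf3 0 1 2 (by decide) (by decide) (by decide)
  have eq_one_of_dvd : ∀ m, m ∣ a 0 → m ∣ a 1 → m ∣ a 2 → m = 1 := fun m h0 h1 h2 =>
    Nat.dvd_one.mp (h012 ▸ Nat.dvd_gcd (Nat.dvd_gcd h0 h1) h2)
  have hk1 : k = 1 := by
    have hd3 : k ∣ a 3 := h3 ▸ Dvd.intro_left s rfl
    have hd1 : k ∣ a 1 := hk ▸ dvd_add hd3 dvd_rfl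
    have hd2 : k ∣ a 2 := h2 ▸ Dvd.intro_left 3 rfl
    refine eq_one_of_dvd k ?_ hd1 hd2
    have h : a 0 + a 2 = 2 * a 1 := by lia
    exact (Nat.dvd_add_left hd2).mp (h ▸ hd1.mul_left 2)
  subst hk1
  have hs0 : ¬ 3 ∣ s := fun h => by
    have h3d : 3 ∣ d := (Nat.dvd_gcd (by lia) (by lia)).trans (hwf2 2 3 (by decide))
    lia
  have hs2 : ¬ 3 ∣ s + 1 := fun h => by
    have := eq_one_of_dvd 3 (by lia) (by lia) (by lia)
    lia
  refine ⟨s / 3, by lia, ?_⟩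
  simp only [Prod.mk.injEq]
  lia
end

section
/- Let $a_0, a_1, a_2, a_3$ be positive integers and let $r, s$ be integers with $r \ge 2$ and $s \ge 2$ such that $2a_0 = 2a_1 + a_3 = r\,a_2 + a_3 = a_1 + s\,a_3$, and put $d = 2a_0$. Suppose that $\gcd(a_i,a_j,a_k)=1$ for all pairwise distinct indices $i,j,k$ and $\gcd(a_i,a_j)$ divides $d$ for all distinct indices $i,j$. Then $(a_0, a_1, a_2, a_3, d) = (2s-1, 2s-2, 1, 2, 4s-2)$. -/
/-- Case IX.2(1) of the Yau–Yu classification: the defining polynomial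
`x² + y²w + zʳw + ywˢ + ⋯` with `r, s ≥ 2` and a well-formed weight system
yields only `(2s-1, 2s-2, 1, 2, 4s-2)`. -/
theorem case_IX_2_1 (a : Fin 4 → ℕ) (d r s : ℕ) (hpos : ∀ i, 0 < a i)
    (hr : 2 ≤ r) (hs : 2 ≤ s)
    (e1 : 2 * a 0 = 2 * a 1 + a 3)
    (e2 : 2 * a 0 = r * a 2 + a 3)
    (e3 : 2 * a 0 = a 1 + s * a 3)
    (hd : d = 2 * a 0)
    (hwf3 : ∀ i j k : Fin 4, i ≠ j → i ≠ k → j ≠ k →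
      Nat.gcd (Nat.gcd (a i) (a j)) (a k) = 1)
    (hwf2 : ∀ i j : Fin 4, i ≠ j → Nat.gcd (a i) (a j) ∣ d) :
    (a 0, a 1, a 2, a 3, d) = (2 * s - 1, 2 * s - 2, 1, 2, 4 * s - 2) := by
  obtain ⟨t, rfl⟩ : ∃ t, s = t + 1 := ⟨s - 1, by omega⟩
  obtain ⟨c, hc⟩ : ∃ c, a 3 = 2 * c := ⟨a 0 - a 1, by omega⟩
  have h1 : a 1 = 2 * (t * c) := by rw [hc] at e1 e3; linarith
  have h0 : a 0 = 2 * (t * c) + c := by omega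
  have hc1 : c = 1 := by
    have h := hwf3 0 1 3 (by decide) (by decide) (by decide)
    refine Nat.dvd_one.mp (h ▸ Nat.dvd_gcd (Nat.dvd_gcd ?_ ?_) ?_)
    · exact ⟨2 * t + 1, by rw [h0]; ring⟩
    · exact ⟨2 * t, by rw [h1]; ring⟩
    · exact ⟨2, by rw [hc]; ring⟩
  subst hc1
  have hodd : Nat.Coprime (a 2) 2 := by
    have h := hwf3 1 2 3 (by decide) (by decide) (by decide)
    refine Nat.dvd_one.mp (h ▸ Nat.dvd_gcd (Nat.dvd_gcd ?_ (Nat.gcd_dvd_left _ _)) ?_)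
    · exact (Nat.gcd_dvd_right _ _).trans ⟨t * 1, h1⟩
    · exact (Nat.gcd_dvd_right _ _).trans ⟨1, hc⟩
  have hdvd1 : a 2 ∣ a 1 :=
    hodd.dvd_of_dvd_mul_left ⟨r, by linarith⟩
  have hdvd : a 2 ∣ 2 * a 1 + 2 := by
    have h := (Nat.dvd_gcd hdvd1 dvd_rfl).trans (hwf2 1 2 (by decide))
    rwa [hd, e1, hc] at h
  have h2 : a 2 = 1 :=
    hodd.eq_one_of_dvd ((Nat.dvd_add_right (hdvd1.mul_left 2)).mp hdvd)
  simp only [Prod.mk.injEq]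
  omega
end

section
/- Let $a_0, a_1, a_2, a_3$ be positive integers and let $s$ be an integer with $s \ge 3$ such that $3a_0 + a_1 = a_0 + 3a_1 = s\,a_2 = a_2 + 2a_3$, and put $d = 3a_0 + a_1$. Suppose that $\gcd(a_i,a_j,a_k)=1$ for all pairwise distinct indices $i,j,k$ and $\gcd(a_i,a_j)$ divides $d$ for all distinct indices $i,j$. Then there exists a positive integer $n$ such that either $(a_0, a_1, a_2, a_3, d) = (2n+1, 2n+1, 2, 4n+1, 8n+4)$ or $(a_0, a_1, a_2, a_3, d) = (2n+1, 2n+1, 4, 4n, 8n+4)$. -/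
/-- Case V.3(4) of the Yau–Yu classification: the defining polynomial
`yx³ + xy³ + zˢ + zw²` with `s ≥ 3` and a well-formed weight system yields
the series `(2n+1, 2n+1, 2, 4n+1, 8n+4)` (index 1) and
`(2n+1, 2n+1, 4, 4n, 8n+4)` (index 2). -/
theorem case_V_3_4 (a : Fin 4 → ℕ) (d s : ℕ) (hpos : ∀ i, 0 < a i)
    (hs : 3 ≤ s)
    (e1 : 3 * a 0 + a 1 = a 0 + 3 * a 1)
    (e2 : 3 * a 0 + a 1 = s * a 2)
    (e3 : 3 * a 0 + a 1 = a 2 + 2 * a 3)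
    (hd : d = 3 * a 0 + a 1)
    (hwf3 : ∀ i j k : Fin 4, i ≠ j → i ≠ k → j ≠ k →
      Nat.gcd (Nat.gcd (a i) (a j)) (a k) = 1)
    (hwf2 : ∀ i j : Fin 4, i ≠ j → Nat.gcd (a i) (a j) ∣ d) :
    ∃ n : ℕ, 0 < n ∧
      ((a 0, a 1, a 2, a 3, d) = (2 * n + 1, 2 * n + 1, 2, 4 * n + 1, 8 * n + 4) ∨
        (a 0, a 1, a 2, a 3, d) = (2 * n + 1, 2 * n + 1, 4, 4 * n, 8 * n + 4)) := by
  have h01 : a 1 = a 0 := by omega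
  have hco : Nat.Coprime (a 2) (a 0) := by
    have h := hwf3 0 1 2 (by decide) (by decide) (by decide)
    rw [h01, Nat.gcd_self] at h
    exact Nat.Coprime.symm h
  have hdvd : a 2 ∣ 4 := by
    refine hco.dvd_of_dvd_mul_right ⟨s, ?_⟩
    linarith
  have hle : a 2 ≤ 4 := Nat.le_of_dvd (by norm_num) hdvd
  have h2 : a 2 = 2 ∨ a 2 = 4 := by
    have := hpos 2
    omega
  have hodd : a 0 % 2 = 1 := by
    by_contra h
    have h1 : 2 ∣ Nat.gcd (a 2) (a 0) := Nat.dvd_gcd (by omega) (by omega)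
    rw [hco] at h1
    omega
  simp only [Prod.mk.injEq]
  refine ⟨a 0 / 2, ?_, ?_⟩ <;> rcases h2 with h2 | h2 <;> rw [h2] at e2 <;> omega
end

section
/- Let $a_0, a_1, a_2, a_3$ be positive integers and let $s$ be an integer with $s \ge 3$ such that $3a_0 = a_0 + 3a_1 = a_1 + s\,a_2 = a_2 + 2a_3$, and put $d = 3a_0$. Suppose that $\gcd(a_i,a_j,a_k)=1$ for all pairwise distinct indices $i,j,k$ and $\gcd(a_i,a_j)$ divides $d$ for all distinct indices $i,j$. Then either there exists a positive integer $n$ with $(a_0, a_1, a_2, a_3, d) = (6n-3, 4n-2, 1, 9n-5, 18n-9)$, or there exists a positive integer $k$ with $k \not\equiv 3 \pmod 7$ and $(a_0, a_1, a_2, a_3, d) = (6k+3, 4k+2, 7, 9k+1, 18k+9)$. -/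
/-- Case XI.3(14) of the Yau–Yu classification: the defining polynomial
`x³ + xy³ + yzˢ + zw²` with `s ≥ 3` and a well-formed weight system yields
the series `(6n-3, 4n-2, 1, 9n-5, 18n-9)` and, for `k ≢ 3 (mod 7)`,
`(6k+3, 4k+2, 7, 9k+1, 18k+9)`. -/
theorem case_XI_3_14 (a : Fin 4 → ℕ) (d s : ℕ) (hpos : ∀ i, 0 < a i)
    (hs : 3 ≤ s)
    (e1 : 3 * a 0 = a 0 + 3 * a 1)
    (e2 : 3 * a 0 = a 1 + s * a 2)
    (e3 : 3 * a 0 = a 2 + 2 * a 3)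
    (hd : d = 3 * a 0)
    (hwf3 : ∀ i j k : Fin 4, i ≠ j → i ≠ k → j ≠ k →
      Nat.gcd (Nat.gcd (a i) (a j)) (a k) = 1)
    (hwf2 : ∀ i j : Fin 4, i ≠ j → Nat.gcd (a i) (a j) ∣ d) :
    (∃ n : ℕ, 0 < n ∧
      (a 0, a 1, a 2, a 3, d) =
        (6 * n - 3, 4 * n - 2, 1, 9 * n - 5, 18 * n - 9)) ∨
    (∃ k : ℕ, 0 < k ∧ k % 7 ≠ 3 ∧
      (a 0, a 1, a 2, a 3, d) =
        (6 * k + 3, 4 * k + 2, 7, 9 * k + 1, 18 * k + 9)) := by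
  obtain ⟨t, h0, h1⟩ : ∃ t, a 0 = 3 * t ∧ a 1 = 2 * t := ⟨a 0 - a 1, by lia, by lia⟩
  have hs7 : s * a 2 = 7 * t := by lia
  have hcop : Nat.Coprime (a 2) t := by
    have h := hwf3 0 1 2 (by decide) (by decide) (by decide)
    rw [h0, h1, Nat.gcd_mul_right, show Nat.gcd 3 2 = 1 from rfl, one_mul] at h
    exact Nat.Coprime.symm h
  have hdvd : a 2 ∣ 7 := hcop.dvd_of_dvd_mul_right ⟨s, by rw [← hs7, mul_comm]⟩
  simp only [Prod.mk.injEq]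
  rcases (Nat.dvd_prime (by norm_num)).mp hdvd with h2 | h2
  · exact Or.inl ⟨(t + 1) / 2, by lia⟩
  · have h7 : ¬ 7 ∣ t := by
      rw [h2] at hcop
      exact (Nat.Prime.coprime_iff_not_dvd (by norm_num)).mp hcop
    exact Or.inr ⟨t / 2, by lia⟩
end

section
/- Let $a_0, a_1, a_2, a_3$ be positive integers and let $r, s, t$ be integers with $r, s, t \ge 2$ such that $r\,a_0 = a_0 + a_1 = a_0 + s\,a_2 = a_0 + t\,a_3$, and put $d = r\,a_0$. Suppose that $\gcd(a_i,a_j,a_k)=1$ for all pairwise distinct indices $i,j,k$ and $\gcd(a_i,a_j)$ divides $d$ for all distinct indices $i,j$. Then $a_2 = a_3 = 1$ and $(a_0, a_1, a_2, a_3, d) = (a, m a, 1, 1, (m+1)a)$ where $a = a_0$ and $m = r - 1$; in particular the index equals $2$. -/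
/-- In a well-formed triple of weights `x, y, z` with `z ∣ y`, if `gcd (y, z)` divides `x + y`,
then `z = 1`. -/
theorem eq_one_of_dvd_of_gcd_dvd_add {x y z : ℕ} (hzy : z ∣ y) (hadd : Nat.gcd y z ∣ x + y)
    (hgcd : Nat.gcd (Nat.gcd x y) z = 1) : z = 1 := by
  rw [Nat.gcd_eq_right hzy] at hadd
  have hzx : z ∣ x := (Nat.dvd_add_left hzy).mp hadd
  rwa [Nat.gcd_eq_right (Nat.dvd_gcd hzx hzy)] at hgcd


/-- Case XIV.1(1) of the Yau–Yu classification: the defining polynomial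
`xʳ + xy + xzˢ + xwᵗ + ⋯` with `r, s, t ≥ 2` and a well-formed weight
system gives `(a₀, a₁, a₂, a₃, d) = (a, ma, 1, 1, (m+1)a)` with
`a = a₀`, `m = r - 1`; in particular the index equals `2`. -/
theorem case_XIV_1_1 (a : Fin 4 → ℕ) (d r s t : ℕ) (hpos : ∀ i, 0 < a i)
    (hr : 2 ≤ r) (hs : 2 ≤ s) (ht : 2 ≤ t)
    (e1 : r * a 0 = a 0 + a 1)
    (e2 : r * a 0 = a 0 + s * a 2)
    (e3 : r * a 0 = a 0 + t * a 3)
    (hd : d = r * a 0)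
    (hwf3 : ∀ i j k : Fin 4, i ≠ j → i ≠ k → j ≠ k →
      Nat.gcd (Nat.gcd (a i) (a j)) (a k) = 1)
    (hwf2 : ∀ i j : Fin 4, i ≠ j → Nat.gcd (a i) (a j) ∣ d) :
    a 2 = 1 ∧ a 3 = 1 ∧ a 1 = (r - 1) * a 0 ∧ d = ((r - 1) + 1) * a 0 ∧
      a 0 + a 1 + a 2 + a 3 = d + 2 := by
  have hd' : d = a 0 + a 1 := hd.trans e1
  have h2 : a 2 = 1 := eq_one_of_dvd_of_gcd_dvd_add (x := a 0) (y := a 1)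
    ⟨s, by linarith⟩ (hd' ▸ hwf2 1 2 (by decide))
    (hwf3 0 1 2 (by decide) (by decide) (by decide))
  have h3 : a 3 = 1 := eq_one_of_dvd_of_gcd_dvd_add (x := a 0) (y := a 1)
    ⟨t, by linarith⟩ (hd' ▸ hwf2 1 3 (by decide))
    (hwf3 0 1 3 (by decide) (by decide) (by decide))
  refine ⟨h2, h3, ?_, ?_, by omega⟩
  · rw [Nat.sub_mul, e1, one_mul, Nat.add_sub_cancel_left]
  · rw [Nat.sub_add_cancel (by omega), hd]
end
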